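/- There exist absolute constants C > 0 and c₀ ∈ (0,1) such that the following holds. For all positive integers n, k, d with k < n and all ε ∈ (0, c₀), if nmExt : {0,1}^n × {0,1}^d → {0,1} is a (k,ε)-non-malleable extractor, then k ≥ log₂(log₂(n − k)) + 2·log₂(1/ε) − log₂(log₂(1/ε)) − C. In particular, non-malleable extractors with k ≤ n/2 and constant ε require min-entropy k = Ω(log log n). -/

import Mathlib

open Finset

/-- Total variation distance between two distributions on a finite type,
defined as the supremum over events of the difference of probabilities. -/
noncomputable def tvDist {Ω : Type*} [Fintype Ω] (p q : Ω → ℝ) : ℝ :=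
  ⨆ S : Finset Ω, |∑ ω ∈ S, p ω - ∑ ω ∈ S, q ω|

/-- Distribution of `f a` when `a` is drawn uniformly from the finite set `A`. -/
noncomputable def unifPush {α Ω : Type*} [DecidableEq Ω] (A : Finset α) (f : α → Ω) :
    Ω → ℝ :=
  fun ω => ((A.filter fun a => f a = ω).card : ℝ) / (A.card : ℝ)

/-- An adversarial function: a map on seeds with no fixed points. -/
def Adversarial {d : ℕ} (A : (Fin d → Bool) → (Fin d → Bool)) : Prop :=
  ∀ s, A s ≠ s

/-- Distribution of the tuple `(nmExt(X,U_d), nmExt(X,A(U_d)), U_d)` for `X` uniform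
on the finset `X` and `U_d` an independent uniform seed. -/
noncomputable def realDist {n d : ℕ} (nmExt : (Fin n → Bool) → (Fin d → Bool) → Bool)
    (X : Finset (Fin n → Bool)) (A : (Fin d → Bool) → (Fin d → Bool)) :
    Bool × Bool × (Fin d → Bool) → ℝ :=
  unifPush (X ×ˢ (Finset.univ : Finset (Fin d → Bool)))
    (fun p => (nmExt p.1 p.2, nmExt p.1 (A p.2), p.2))

/-- Distribution of the tuple `(U_1, nmExt(X,A(U_d)), U_d)`, with `U_1` a uniform bit
independent of `X` and `U_d`. -/
noncomputable def idealDist {n d : ℕ} (nmExt : (Fin n → Bool) → (Fin d → Bool) → Bool)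
    (X : Finset (Fin n → Bool)) (A : (Fin d → Bool) → (Fin d → Bool)) :
    Bool × Bool × (Fin d → Bool) → ℝ :=
  unifPush ((Finset.univ : Finset Bool) ×ˢ X ×ˢ (Finset.univ : Finset (Fin d → Bool)))
    (fun p => (p.1, nmExt p.2.1 (A p.2.2), p.2.2))

/-- `nmExt` is a `(k,ε)`-non-malleable extractor: for every flat `(n,k)`-source `X`
and every adversarial function `A`, the real and ideal distributions are `ε`-close
in total variation distance. -/
def IsNonMalleableExtractor (n k d : ℕ) (ε : ℝ)
    (nmExt : (Fin n → Bool) → (Fin d → Bool) → Bool) : Prop :=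
  ∀ X : Finset (Fin n → Bool), X.card = 2 ^ k →
    ∀ A : (Fin d → Bool) → (Fin d → Bool), Adversarial A →
      tvDist (realDist nmExt X A) (idealDist nmExt X A) ≤ ε

/-- sign of a bit -/
def sg (b : Bool) : ℝ := if b then 1 else -1

lemma sg_sq (b : Bool) : sg b * sg b = 1 := by cases b <;> simp [sg]

lemma sum_unifPush {α Ω : Type*} [DecidableEq Ω] (A : Finset α) (f : α → Ω) (S : Finset Ω) :
    ∑ ω ∈ S, unifPush A f ω = ((A.filter fun a => f a ∈ S).card : ℝ) / (A.card : ℝ) := by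
  unfold unifPush
  rw [← Finset.sum_div]
  congr 1
  have := Finset.card_eq_sum_card_fiberwise (f := f) (s := A.filter fun a => f a ∈ S) (t := S)
    (by intro a ha; simpa using (Finset.mem_filter.1 (Finset.mem_coe.1 ha)).2)
  rw [this]
  push_cast
  apply Finset.sum_congr rfl
  intro ω hω
  congr 2
  ext a
  simp only [Finset.mem_filter]
  constructor
  · rintro ⟨h, rfl⟩; exact ⟨⟨h, hω⟩, rfl⟩
  · rintro ⟨⟨h, _⟩, h2⟩; exact ⟨h, h2⟩

lemma le_tvDist {Ω : Type*} [Fintype Ω] (p q : Ω → ℝ) (S : Finset Ω) :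
    |∑ ω ∈ S, p ω - ∑ ω ∈ S, q ω| ≤ tvDist p q := by
  unfold tvDist
  exact le_ciSup (f := fun S : Finset Ω => |∑ ω ∈ S, p ω - ∑ ω ∈ S, q ω|)
    (Set.finite_range _).bddAbove S

/-- Basic test. -/
lemma basic_test {n k d : ℕ} {ε : ℝ} {f : (Fin n → Bool) → (Fin d → Bool) → Bool}
    (hf : IsNonMalleableExtractor n k d ε f) (X : Finset (Fin n → Bool)) (hX : X.card = 2 ^ k)
    (A : (Fin d → Bool) → (Fin d → Bool)) (hA : Adversarial A)
    (h : Bool → (Fin d → Bool) → Bool) :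
    ∑ s, ∑ x ∈ X, sg (f x s) * sg (h (f x (A s)) s) ≤ 2 * ε * (2 ^ k * 2 ^ d) := by
  classical
  have h1 := hf X hX A hA
  set S : Finset (Bool × Bool × (Fin d → Bool)) :=
    Finset.univ.filter fun p => p.1 = h p.2.1 p.2.2 with hS
  have h2 := (le_abs_self _).trans ((le_tvDist (realDist f X A) (idealDist f X A) S).trans h1)
  unfold realDist idealDist at h2
  rw [sum_unifPush, sum_unifPush] at h2
  have c1 : ((X ×ˢ (Finset.univ : Finset (Fin d → Bool))).card : ℝ) = 2 ^ k * 2 ^ d := by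
    simp [hX]
  have c2 : (((Finset.univ : Finset Bool) ×ˢ X ×ˢ (Finset.univ : Finset (Fin d → Bool))).card : ℝ)
      = 2 * (2 ^ k * 2 ^ d) := by
    simp [hX]
  have e2 : ((((Finset.univ : Finset Bool) ×ˢ X ×ˢ (Finset.univ : Finset (Fin d → Bool))).filter
      fun p => ((p.1, f p.2.1 (A p.2.2), p.2.2) : Bool × Bool × (Fin d → Bool)) ∈ S).card : ℝ)
      = 2 ^ k * 2 ^ d := by
    rw [Finset.card_filter]
    push_cast
    rw [Finset.sum_product]
    simp only [hS, Finset.mem_filter, Finset.mem_univ, true_and]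
    rw [Finset.sum_comm]
    simp [hX]
  have e1 : ∑ s, ∑ x ∈ X, sg (f x s) * sg (h (f x (A s)) s) =
      2 * (((X ×ˢ (Finset.univ : Finset (Fin d → Bool))).filter
      fun p => ((f p.1 p.2, f p.1 (A p.2), p.2) : Bool × Bool × (Fin d → Bool)) ∈ S).card : ℝ)
      - 2 ^ k * 2 ^ d := by
    rw [← c1, Finset.card_filter, Finset.card_eq_sum_ones]
    push_cast
    rw [Finset.mul_sum, ← Finset.sum_sub_distrib, Finset.sum_product_right]
    apply Finset.sum_congr rfl
    intro s _
    apply Finset.sum_congr rfl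
    intro x _
    simp only [hS, Finset.mem_filter, Finset.mem_univ, true_and]
    cases f x s <;> cases h (f x (A s)) s <;> norm_num [sg]
  rw [c1, c2, e2] at h2
  have hp : (0 : ℝ) < 2 ^ k * 2 ^ d := by positivity
  rw [e1]
  set Q := (((X ×ˢ (Finset.univ : Finset (Fin d → Bool))).filter
      fun p => ((f p.1 p.2, f p.1 (A p.2), p.2) : Bool × Bool × (Fin d → Bool)) ∈ S).card : ℝ)
  set P : ℝ := 2 ^ k * 2 ^ d
  have : Q / P - P / (2 * P) = (2 * Q - P) / (2 * P) := by field_simp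
  rw [this, div_le_iff₀ (by positivity)] at h2
  linarith

lemma abs_eq_sg (z : ℝ) : ∃ b, |z| = z * sg b := by
  rcases le_total 0 z with h | h
  · exact ⟨true, by simp [sg, abs_of_nonneg h]⟩
  · exact ⟨false, by simp [sg, abs_of_nonpos h]⟩

lemma bias_test {n k d : ℕ} {ε : ℝ} {f : (Fin n → Bool) → (Fin d → Bool) → Bool} (hd : 0 < d)
    (hf : IsNonMalleableExtractor n k d ε f) (X : Finset (Fin n → Bool)) (hX : X.card = 2 ^ k) :
    ∑ s, |∑ x ∈ X, sg (f x s)| ≤ 2 * ε * (2 ^ k * 2 ^ d) := by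
  choose τ hτ using fun s => abs_eq_sg (∑ x ∈ X, sg (f x s))
  have := basic_test hf X hX (fun s i => !(s i)) (by
    intro s h
    have := congrFun h ⟨0, hd⟩
    simp at this) (fun _ s => τ s)
  simp only [hτ, Finset.sum_mul]
  exact this

lemma corr_test {n k d : ℕ} {ε : ℝ} {f : (Fin n → Bool) → (Fin d → Bool) → Bool}
    (hf : IsNonMalleableExtractor n k d ε f) (X : Finset (Fin n → Bool)) (hX : X.card = 2 ^ k)
    (A : (Fin d → Bool) → (Fin d → Bool)) (hA : Adversarial A) :
    ∑ s, |∑ x ∈ X, sg (f x s) * sg (f x (A s))| ≤ 2 * ε * (2 ^ k * 2 ^ d) := by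
  choose τ hτ using fun s => abs_eq_sg (∑ x ∈ X, sg (f x s) * sg (f x (A s)))
  have := basic_test hf X hX A hA (fun b s => b == τ s)
  simp only [hτ, Finset.sum_mul]
  refine le_trans (le_of_eq ?_) this
  apply Finset.sum_congr rfl
  intro s _
  apply Finset.sum_congr rfl
  intro x _
  cases f x s <;> cases f x (A s) <;> cases τ s <;> simp [sg]

/-- pigeonhole seed bound -/
lemma seed_bound {n k d : ℕ} {ε : ℝ} {f : (Fin n → Bool) → (Fin d → Bool) → Bool} (hd : 0 < d)
    (hkn : k < n) (hε : ε < 1 / 2)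
    (hf : IsNonMalleableExtractor n k d ε f) : n - k ≤ 2 ^ d := by
  classical
  by_contra hlt
  push Not at hlt
  obtain ⟨y, hy⟩ := Fintype.exists_le_card_fiber_of_mul_le_card (n := 2 ^ k)
    (f : (Fin n → Bool) → ((Fin d → Bool) → Bool)) (by
      simp only [Fintype.card_fun, Fintype.card_bool, Fintype.card_fin]
      rw [← pow_add]
      exact Nat.pow_le_pow_right (by norm_num) (by omega))
  obtain ⟨X, hXs, hX⟩ := Finset.exists_subset_card_eq hy
  have hb := bias_test hd hf X hX
  have : ∀ s, |∑ x ∈ X, sg (f x s)| = 2 ^ k := by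
    intro s
    have : ∑ x ∈ X, sg (f x s) = ∑ x ∈ X, sg (y s) := by
      apply Finset.sum_congr rfl
      intro x hx
      have := hXs hx
      simp only [Finset.mem_filter, Finset.mem_univ, true_and] at this
      rw [this]
    rw [this, Finset.sum_const, hX]
    cases y s <;> simp [sg]
  simp only [this] at hb
  simp at hb
  have hp : (0 : ℝ) < 2 ^ k * 2 ^ d := by positivity
  nlinarith
/-- Welch / Alon type inequality. -/
lemma welch {ι κ : Type*} [Fintype κ] [DecidableEq κ] [DecidableEq ι] (G : Finset ι)
    (v : ι → κ → ℝ) (hv : ∀ i a, v i a * v i a = 1) (δ : ℝ)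
    (hδ : ∀ i ∈ G, ∀ j ∈ G, i ≠ j → |∑ a, v i a * v j a| ≤ δ * Fintype.card κ) (t : ℕ) :
    (G.card : ℝ) ^ 2 * ((Fintype.card κ).descFactorial t * t.factorial : ℕ) ≤
      G.card * (Fintype.card κ : ℝ) ^ (2 * t) +
        (G.card : ℝ) ^ 2 * (δ * Fintype.card κ) ^ (2 * t) := by
  classical
  set K : ℝ := ((Fintype.card κ : ℕ) : ℝ) with hK
  have key : ∑ i ∈ G, ∑ j ∈ G, (∑ a, v i a * v j a) ^ (2 * t) =
      ∑ p : (Fin t → κ) × (Fin t → κ),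
        (∑ i ∈ G, (∏ l, v i (p.1 l)) * ∏ l, v i (p.2 l)) ^ 2 := by
    have h1 : ∀ i j, (∑ a, v i a * v j a) ^ (2 * t) =
        ∑ p : (Fin t → κ) × (Fin t → κ), ((∏ l, v i (p.1 l)) * ∏ l, v i (p.2 l)) *
          ((∏ l, v j (p.1 l)) * ∏ l, v j (p.2 l)) := by
      intro i j
      rw [two_mul, pow_add, Fintype.sum_pow, Finset.sum_mul_sum, Fintype.sum_prod_type]
      apply Finset.sum_congr rfl; intro β _
      apply Finset.sum_congr rfl; intro γ _
      simp only [Finset.prod_mul_distrib]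
      ring
    simp only [h1, sq, Finset.sum_mul_sum]
    conv_rhs => rw [Finset.sum_comm]
    apply Finset.sum_congr rfl; intro i _
    rw [Finset.sum_comm]
  have upper : ∑ i ∈ G, ∑ j ∈ G, (∑ a, v i a * v j a) ^ (2 * t) ≤
      G.card * K ^ (2 * t) + (G.card : ℝ) ^ 2 * (δ * K) ^ (2 * t) := by
    have h2 : ∀ i ∈ G, ∀ j ∈ G, (∑ a, v i a * v j a) ^ (2 * t) ≤
        (if i = j then K ^ (2 * t) else 0) + (δ * K) ^ (2 * t) := by
      intro i hi j hj
      have hnn : 0 ≤ (δ * K) ^ (2 * t) := by rw [pow_mul]; positivity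
      split_ifs with h
      · subst h
        simp only [hv]
        simp [← hK, hnn]
      · rw [zero_add, ← Even.pow_abs (even_two_mul t)]
        exact pow_le_pow_left₀ (abs_nonneg _) (hδ i hi j hj h) _
    calc _ ≤ ∑ i ∈ G, ∑ j ∈ G, ((if i = j then K ^ (2 * t) else 0) + (δ * K) ^ (2 * t)) :=
          Finset.sum_le_sum fun i hi => Finset.sum_le_sum fun j hj => h2 i hi j hj
      _ = _ := by
          simp only [Finset.sum_add_distrib, Finset.sum_ite_eq, Finset.sum_const]
          simp [Finset.sum_ite_mem]
          ring
  have lower : (G.card : ℝ) ^ 2 * ((Fintype.card κ).descFactorial t * t.factorial : ℕ) ≤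
      ∑ p : (Fin t → κ) × (Fin t → κ),
        (∑ i ∈ G, (∏ l, v i (p.1 l)) * ∏ l, v i (p.2 l)) ^ 2 := by
    let φ : (Fin t ↪ κ) × Equiv.Perm (Fin t) → (Fin t → κ) × (Fin t → κ) :=
      fun q => (q.1, fun l => q.1 (q.2 l))
    have hφ : Function.Injective φ := by
      rintro ⟨β, π⟩ ⟨β', π'⟩ h
      simp only [φ, Prod.mk.injEq] at h
      obtain ⟨h1, h2⟩ := h
      have : β = β' := DFunLike.coe_injective h1
      subst this
      have : π = π' := by
        ext l
        have := β.injective (congrFun h2 l)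
        rw [this]
      rw [this]
    calc _ = ∑ q : (Fin t ↪ κ) × Equiv.Perm (Fin t),
          (∑ i ∈ G, (∏ l, v i ((φ q).1 l)) * ∏ l, v i ((φ q).2 l)) ^ 2 := by
          have : ∀ q : (Fin t ↪ κ) × Equiv.Perm (Fin t),
              (∑ i ∈ G, (∏ l, v i ((φ q).1 l)) * ∏ l, v i ((φ q).2 l)) ^ 2 = (G.card : ℝ) ^ 2 := by
            intro q
            have : ∀ i, (∏ l, v i ((φ q).1 l)) * ∏ l, v i ((φ q).2 l) = 1 := by
              intro i
              have e : ∏ l, v i ((φ q).2 l) = ∏ l, v i ((φ q).1 l) :=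
                Equiv.prod_comp q.2 (fun l => v i (q.1 l))
              rw [e, ← Finset.prod_mul_distrib]
              simp [hv]
            simp [this]
          simp only [this, Finset.sum_const, Finset.card_univ, Fintype.card_prod,
            Fintype.card_embedding_eq, Fintype.card_perm, Fintype.card_fin, nsmul_eq_mul]
          ring
      _ = ∑ p ∈ Finset.univ.image φ,
          (∑ i ∈ G, (∏ l, v i (p.1 l)) * ∏ l, v i (p.2 l)) ^ 2 := by
          rw [Finset.sum_image (fun a _ b _ h => hφ h)]
      _ ≤ _ := by
          apply Finset.sum_le_sum_of_subset_of_nonneg (Finset.subset_univ _)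
          intros; positivity
  linarith [key ▸ upper]

lemma alon_core {m K : ℝ} {Kn t : ℕ} (hKn : K = Kn) (ht : 1 ≤ t) (htK : 2 * t ≤ Kn) {δ : ℝ}
    (hδ : 0 < δ) (hm : 0 < m)
    (hmt : 1 ≤ m * δ ^ (2 * t))
    (hw : m ^ 2 * (Kn.descFactorial t * t.factorial : ℕ) ≤
      m * K ^ (2 * t) + m ^ 2 * (δ * K) ^ (2 * t)) :
    (t : ℝ) ≤ 12 * δ ^ 2 * K := by
  have hK : 0 < K := by rw [hKn]; exact_mod_cast (by omega : 0 < Kn)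
  have ht0 : (0 : ℝ) < t := by exact_mod_cast ht
  have f1 : (K / 2) ^ t ≤ (Kn.descFactorial t : ℝ) := by
    have := Nat.pow_sub_le_descFactorial Kn t
    have h2 : (K / 2) ^ t ≤ (((Kn + 1 - t : ℕ) : ℝ)) ^ t := by
      apply pow_le_pow_left₀ (by positivity)
      rw [Nat.cast_sub (by omega), hKn]
      push_cast
      have : (2 : ℝ) * t ≤ Kn := by exact_mod_cast htK
      linarith
    exact h2.trans (by exact_mod_cast this)
  have f2 : (t / 3 : ℝ) ^ t ≤ t.factorial := by
    have := Real.pow_div_factorial_le_exp (t : ℝ) ht0.le t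
    have h3 : Real.exp t ≤ 3 ^ t := by
      rw [← mul_one (t : ℝ), Real.exp_nat_mul]
      exact pow_le_pow_left₀ (Real.exp_pos _).le (Real.exp_one_lt_d9.le.trans (by norm_num)) _
    rw [div_le_iff₀ (by positivity)] at this
    rw [div_pow, div_le_iff₀ (by positivity)]
    nlinarith [(by positivity : (0 : ℝ) < t.factorial)]
  have f3 : (K / 2) ^ t * (t / 3 : ℝ) ^ t ≤ (Kn.descFactorial t * t.factorial : ℕ) := by
    push_cast
    exact mul_le_mul f1 f2 (by positivity) (by positivity)
  have f4 : m ^ 2 * (Kn.descFactorial t * t.factorial : ℕ) ≤ m ^ 2 * (2 * (δ * K) ^ (2 * t)) := by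
    refine hw.trans ?_
    have : m * K ^ (2 * t) * 1 ≤ m * K ^ (2 * t) * (m * δ ^ (2 * t)) :=
      mul_le_mul_of_nonneg_left hmt (by positivity)
    rw [mul_pow]
    nlinarith
  have f5 := f3.trans (le_of_mul_le_mul_left f4 (by positivity))
  have f6 : (2 : ℝ) ≤ 2 ^ t := by
    calc (2 : ℝ) = 2 ^ 1 := by norm_num
      _ ≤ _ := pow_le_pow_right₀ (by norm_num) ht
  have f7 : (K / 2 * (t / 3)) ^ t ≤ (2 * (δ * K) ^ 2) ^ t := by
    rw [mul_pow, mul_pow 2, ← pow_mul]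
    refine f5.trans (mul_le_mul_of_nonneg_right f6 (by positivity))
  have f8 := le_of_pow_le_pow_left₀ (by omega) (by positivity) f7
  have : K * t ≤ K * (12 * δ ^ 2 * K) := by nlinarith
  exact le_of_mul_le_mul_left this hK
lemma rad_moments (K : ℕ) (a : Fin K → ℝ) :
    ∑ σ : Fin K → Bool, (∑ i, sg (σ i) * a i) ^ 2 = 2 ^ K * ∑ i, a i ^ 2 ∧
    ∑ σ : Fin K → Bool, (∑ i, sg (σ i) * a i) ^ 4 ≤ 2 ^ K * (3 * (∑ i, a i ^ 2) ^ 2) := by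
  induction K with
  | zero => simp
  | succ K ih =>
    obtain ⟨h2, h4⟩ := ih (fun i => a i.succ)
    have red : ∀ p : ℕ, ∑ σ : Fin (K + 1) → Bool, (∑ i, sg (σ i) * a i) ^ p =
        ∑ σ : Fin K → Bool, ((a 0 + ∑ i, sg (σ i) * a i.succ) ^ p +
          (-a 0 + ∑ i, sg (σ i) * a i.succ) ^ p) := by
      intro p
      rw [← (Fin.consEquiv (fun _ : Fin (K + 1) => Bool)).sum_comp, Fintype.sum_prod_type,
        Fintype.sum_bool, ← Finset.sum_add_distrib]
      apply Finset.sum_congr rfl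
      intro σ _
      simp [Fin.sum_univ_succ, Fin.consEquiv, sg]
    rw [red, red, Fin.sum_univ_succ]
    set r := ∑ i : Fin K, a i.succ ^ 2
    have cst : ∀ c : ℝ, ∑ _σ : Fin K → Bool, c = 2 ^ K * c := by intro c; simp
    constructor
    · have : ∀ σ : Fin K → Bool, ((a 0 + ∑ i, sg (σ i) * a i.succ) ^ 2 +
          (-a 0 + ∑ i, sg (σ i) * a i.succ) ^ 2) =
          2 * a 0 ^ 2 + 2 * (∑ i, sg (σ i) * a i.succ) ^ 2 := by intro σ; ring
      simp only [this, Finset.sum_add_distrib, ← Finset.mul_sum, h2, cst]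
      ring
    · have : ∀ σ : Fin K → Bool, ((a 0 + ∑ i, sg (σ i) * a i.succ) ^ 4 +
          (-a 0 + ∑ i, sg (σ i) * a i.succ) ^ 4) =
          2 * a 0 ^ 4 + 12 * a 0 ^ 2 * (∑ i, sg (σ i) * a i.succ) ^ 2 +
            2 * (∑ i, sg (σ i) * a i.succ) ^ 4 := by intro σ; ring
      simp only [this, Finset.sum_add_distrib, ← Finset.mul_sum, h2, cst]
      rw [pow_succ (2 : ℝ) K]
      have : (0 : ℝ) ≤ 2 ^ K * a 0 ^ 4 := by positivity
      nlinarith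

lemma khin (K : ℕ) (hK : 0 < K) (a : Fin K → ℝ) (ha : ∑ i, a i ^ 2 ≤ K) (c : ℝ) :
    2 ^ K * (∑ i, a i ^ 2) ≤
      Real.sqrt (3 * K) * ∑ σ : Fin K → Bool, |c + ∑ i, sg (σ i) * a i| := by
  obtain ⟨h2, h4⟩ := rad_moments K a
  set r := ∑ i, a i ^ 2 with hr
  have hr0 : 0 ≤ r := by positivity
  set t := Real.sqrt (3 * K) with ht
  have hKR : (0 : ℝ) < K := by exact_mod_cast hK
  have ht0 : 0 < t := Real.sqrt_pos.2 (by positivity)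
  have ht2 : t ^ 2 = 3 * K := Real.sq_sqrt (by positivity)
  have sym : ∑ σ : Fin K → Bool, |∑ i, sg (σ i) * a i| ≤
      ∑ σ : Fin K → Bool, |c + ∑ i, sg (σ i) * a i| := by
    have e : ∑ σ : Fin K → Bool, |c + ∑ i, sg (σ i) * a i| =
        ∑ σ : Fin K → Bool, |c - ∑ i, sg (σ i) * a i| := by
      rw [← (Equiv.piCongrRight (fun _ : Fin K => Equiv.boolNot)).sum_comp]
      apply Finset.sum_congr rfl
      intro σ _
      have : ∀ b, sg (!b) = - sg b := by intro b; cases b <;> simp [sg]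
      simp [Equiv.piCongrRight, this, sub_eq_add_neg]
    have : ∑ σ : Fin K → Bool, 2 * |∑ i, sg (σ i) * a i| ≤
        ∑ σ : Fin K → Bool, (|c + ∑ i, sg (σ i) * a i| + |c - ∑ i, sg (σ i) * a i|) := by
      apply Finset.sum_le_sum
      intro σ _
      set R := ∑ i, sg (σ i) * a i
      have := abs_sub (c + R) (c - R)
      rw [show c + R - (c - R) = 2 * R by ring, abs_mul] at this
      simpa using this
    rw [Finset.sum_add_distrib, ← e, ← Finset.mul_sum] at this
    linarith
  have pt : ∀ z : ℝ, 3 * t ^ 2 * z ^ 2 - z ^ 4 ≤ 2 * t ^ 3 * |z| := by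
    intro z
    have h := abs_nonneg z
    rw [← sq_abs z, show z ^ 4 = |z| ^ 4 from (Even.pow_abs (by decide) z).symm]
    set u := |z|
    have : 0 ≤ u * ((u - t) ^ 2 * (u + 2 * t)) := by positivity
    nlinarith
  have s1 : ∑ σ : Fin K → Bool, (3 * t ^ 2 * (∑ i, sg (σ i) * a i) ^ 2 -
      (∑ i, sg (σ i) * a i) ^ 4) ≤ ∑ σ : Fin K → Bool, 2 * t ^ 3 * |∑ i, sg (σ i) * a i| :=
    Finset.sum_le_sum fun σ _ => pt _
  rw [Finset.sum_sub_distrib, ← Finset.mul_sum, ← Finset.mul_sum, h2] at s1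
  set Y := ∑ σ : Fin K → Bool, |∑ i, sg (σ i) * a i|
  have hpow : (0 : ℝ) < 2 ^ K := by positivity
  have s2 : 2 * t ^ 2 * (2 ^ K * r) ≤ 2 * t ^ 2 * (t * Y) := by
    have : (2 : ℝ) ^ K * (3 * r ^ 2) ≤ 2 ^ K * (t ^ 2 * r) := by
      apply mul_le_mul_of_nonneg_left _ hpow.le
      rw [ht2]; nlinarith
    nlinarith
  have s3 := le_of_mul_le_mul_left s2 (by positivity)
  exact s3.trans (mul_le_mul_of_nonneg_left sym ht0.le)

lemma perm_one {V : Type*} [Fintype V] [DecidableEq V] (g : V → ℝ) (i : V) :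
    Fintype.card V * ∑ π : Equiv.Perm V, g (π i) =
      Fintype.card (Equiv.Perm V) * ∑ x, g x := by
  have h : ∀ j, ∑ π : Equiv.Perm V, g (π j) = ∑ π : Equiv.Perm V, g (π i) := by
    intro j
    rw [← Equiv.sum_comp (Equiv.mulRight (Equiv.swap i j))]
    simp
  have h1 : ∑ j, ∑ π : Equiv.Perm V, g (π j) = Fintype.card V * ∑ π : Equiv.Perm V, g (π i) := by
    simp [h]
  rw [← h1, Finset.sum_comm]
  simp [Equiv.sum_comp]

lemma perm_two {V : Type*} [Fintype V] [DecidableEq V] (g : V → ℝ) (hg : ∀ x, g x * g x = 1)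
    (i j : V) (hij : i ≠ j) :
    (Fintype.card V : ℝ) * (Fintype.card V - 1) * ∑ π : Equiv.Perm V, g (π i) * g (π j) =
      Fintype.card (Equiv.Perm V) * ((∑ x, g x) ^ 2 - Fintype.card V) := by
  have h : ∀ i' j', i' ≠ j' → ∑ π : Equiv.Perm V, g (π i') * g (π j') =
      ∑ π : Equiv.Perm V, g (π i) * g (π j) := by
    intro i' j' h'
    obtain ⟨ρ, h1, h2⟩ : ∃ ρ : Equiv.Perm V, ρ i = i' ∧ ρ j = j' := by
      refine ⟨Equiv.swap (Equiv.swap i i' j) j' * Equiv.swap i i', ?_, ?_⟩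
      · simp only [Equiv.Perm.mul_apply, Equiv.swap_apply_left]
        apply Equiv.swap_apply_of_ne_of_ne _ h'
        intro h
        apply hij
        apply (Equiv.swap i i').injective
        simpa using h
      · simp
    rw [← Equiv.sum_comp (Equiv.mulRight ρ) (fun π : Equiv.Perm V => g (π i) * g (π j))]
    simp [h1, h2]
  set T := ∑ π : Equiv.Perm V, g (π i) * g (π j) with hT
  have h1 : ∑ i', ∑ j', ∑ π : Equiv.Perm V, g (π i') * g (π j') =
      Fintype.card (Equiv.Perm V) * (∑ x, g x) ^ 2 := by
    have : ∀ π : Equiv.Perm V, ∑ i', ∑ j', g (π i') * g (π j') = (∑ x, g x) ^ 2 := by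
      intro π
      rw [← Finset.sum_mul_sum, Equiv.sum_comp π g, sq]
    rw [← Finset.card_univ, ← nsmul_eq_mul, ← Finset.sum_const, ← Finset.sum_congr rfl fun π _ => this π]
    conv_rhs => rw [Finset.sum_comm]
    apply Finset.sum_congr rfl
    intro x _
    rw [Finset.sum_comm]
  have h2 : ∀ i' j', ∑ π : Equiv.Perm V, g (π i') * g (π j') =
      T + if i' = j' then (Fintype.card (Equiv.Perm V) - T) else 0 := by
    intro i' j'
    split_ifs with hh
    · subst hh; simp only [hg]; simp
    · rw [h i' j' hh, add_zero]
  simp only [h2, Finset.sum_add_distrib] at h1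
  simp at h1
  linear_combination h1

lemma rand_bias {V : Type*} [Fintype V] [DecidableEq V] (g : V → ℝ) (hg : ∀ x, g x * g x = 1)
    (K : ℕ) (hK : 0 < K) (e : Fin K × Bool ↪ V) :
    Real.sqrt K / 5 * (Fintype.card (Equiv.Perm V) * 2 ^ K) ≤
      ∑ π : Equiv.Perm V, ∑ σ : Fin K → Bool, |∑ i, g (π (e (i, σ i)))| := by
  have hKR : (1 : ℝ) ≤ K := by exact_mod_cast hK
  have hsq : Real.sqrt K ^ 2 = K := Real.sq_sqrt (by positivity)
  have hs1 : 1 ≤ Real.sqrt K := by rw [Real.one_le_sqrt]; exact hKR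
  set F : ℝ := ((Fintype.card (Equiv.Perm V) : ℕ) : ℝ) with hF
  have hF0 : 0 < F := by rw [hF]; exact_mod_cast Fintype.card_pos
  set N : ℝ := ((Fintype.card V : ℕ) : ℝ) with hN
  have hNK : 2 * (K : ℝ) ≤ N := by
    have := Fintype.card_le_of_embedding e
    simp at this
    rw [hN, mul_comm]; exact_mod_cast this
  set S := ∑ x, g x with hS
  have h2K : (0 : ℝ) < 2 ^ K := by positivity
  rcases le_total |S| (N / 2) with hc | hc
  · -- balanced
    have hS2 : S ^ 2 ≤ N ^ 2 / 4 := by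
      rw [← sq_abs]; nlinarith [abs_nonneg S]
    set a : Equiv.Perm V → Fin K → ℝ := fun π i =>
      (g (π (e (i, true))) - g (π (e (i, false)))) / 2 with ha
    have hasq : ∀ π i, a π i ^ 2 = (1 - g (π (e (i, true))) * g (π (e (i, false)))) / 2 := by
      intro π i
      simp only [ha]
      linear_combination (hg (π (e (i, true)))) / 4 + (hg (π (e (i, false)))) / 4
    have hale : ∀ π i, a π i ^ 2 ≤ 1 := by
      intro π i
      rw [hasq]
      nlinarith [hg (π (e (i, true))), hg (π (e (i, false))),
        sq_nonneg (g (π (e (i, true))) + g (π (e (i, false))))]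
    have hkh : ∀ π, 2 ^ K * (∑ i, a π i ^ 2) ≤
        Real.sqrt (3 * K) * ∑ σ : Fin K → Bool, |∑ i, g (π (e (i, σ i)))| := by
      intro π
      have := khin K hK (a π) (by
        calc _ ≤ ∑ i : Fin K, (1 : ℝ) := Finset.sum_le_sum fun i _ => hale π i
          _ = K := by simp) (∑ i, (g (π (e (i, true))) + g (π (e (i, false)))) / 2)
      refine this.trans (le_of_eq ?_)
      congr 1
      apply Finset.sum_congr rfl
      intro σ _
      rw [← Finset.sum_add_distrib]
      congr 1
      apply Finset.sum_congr rfl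
      intro i _
      cases h : σ i <;> simp [sg, ha] <;> ring
    have htot : ∀ i, 3 / 8 * F ≤ ∑ π : Equiv.Perm V, a π i ^ 2 := by
      intro i
      have h2 := perm_two g hg (e (i, true)) (e (i, false)) (by simp)
      simp only [hasq]
      rw [← Finset.sum_div, Finset.sum_sub_distrib]
      simp only [Finset.sum_const, Finset.card_univ, nsmul_eq_mul, mul_one]
      rw [← hF] at h2 ⊢
      rw [← hN, ← hS] at h2
      set T := ∑ π : Equiv.Perm V, g (π (e (i, true))) * g (π (e (i, false)))
      have : N * (N - 1) * T ≤ N * (N - 1) * (F / 4) := by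
        rw [h2]
        have : F * (S ^ 2 - N) ≤ F * (N ^ 2 / 4 - N) := by
          apply mul_le_mul_of_nonneg_left _ hF0.le; linarith
        nlinarith
      have := le_of_mul_le_mul_left this (by nlinarith)
      linarith
    have hsum : 2 ^ K * (K * (3 / 8 * F)) ≤ Real.sqrt (3 * K) *
        ∑ π : Equiv.Perm V, ∑ σ : Fin K → Bool, |∑ i, g (π (e (i, σ i)))| := by
      calc _ ≤ 2 ^ K * ∑ i, ∑ π : Equiv.Perm V, a π i ^ 2 := by
            apply mul_le_mul_of_nonneg_left _ h2K.le
            calc _ = ∑ i : Fin K, 3 / 8 * F := by simp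
              _ ≤ _ := Finset.sum_le_sum fun i _ => htot i
        _ = ∑ π : Equiv.Perm V, 2 ^ K * ∑ i, a π i ^ 2 := by
            rw [Finset.sum_comm, Finset.mul_sum]
        _ ≤ _ := by
            rw [Finset.mul_sum]
            exact Finset.sum_le_sum fun π _ => hkh π
    set Y := ∑ π : Equiv.Perm V, ∑ σ : Fin K → Bool, |∑ i, g (π (e (i, σ i)))|
    have hY : 0 ≤ Y := by positivity
    rw [Real.sqrt_mul (by norm_num)] at hsum
    have h3 : Real.sqrt 3 ≤ 15 / 8 := by
      rw [Real.sqrt_le_left (by norm_num)]; norm_num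
    have h4 : Real.sqrt 3 * Real.sqrt K * Y ≤ 15 / 8 * Real.sqrt K * Y := by gcongr
    have h5 : Real.sqrt K * (15 / 8 * (Real.sqrt K / 5 * (F * 2 ^ K))) ≤
        Real.sqrt K * (15 / 8 * Y) := by
      have : Real.sqrt K * (15 / 8 * (Real.sqrt K / 5 * (F * 2 ^ K))) =
          2 ^ K * (K * (3 / 8 * F)) := by
        linear_combination (3 / 8 * F * 2 ^ K) * hsq
      rw [this]
      linarith
    have := le_of_mul_le_mul_left h5 (by linarith)
    linarith
  · -- unbalanced
    have hone : ∀ v, N * |∑ π : Equiv.Perm V, g (π v)| ≥ N * (F / 2) := by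
      intro v
      have := perm_one g v
      rw [← hN, ← hF, ← hS] at this
      have h2 : N * |∑ π : Equiv.Perm V, g (π v)| = F * |S| := by
        have h3 := congrArg abs this
        rwa [abs_mul, abs_mul, abs_of_pos hF0, abs_of_nonneg (by positivity : 0 ≤ N)] at h3
      rw [h2]
      nlinarith
    have hN0 : 0 < N := by linarith
    have hall : ∀ v w, ∑ π : Equiv.Perm V, g (π v) = ∑ π : Equiv.Perm V, g (π w) := by
      intro v w
      have h1 := perm_one g v
      have h2 := perm_one g w
      rw [← h2] at h1
      exact mul_left_cancel₀ hN0.ne' h1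
    have v0 : V := e (⟨0, hK⟩, true)
    set m := ∑ π : Equiv.Perm V, g (π v0) with hm
    have hmF : F / 2 ≤ |m| := le_of_mul_le_mul_left (hone v0) hN0
    have htot : ∑ π : Equiv.Perm V, ∑ σ : Fin K → Bool, ∑ i, g (π (e (i, σ i))) =
        2 ^ K * (K * m) := by
      rw [Finset.sum_comm]
      have : ∀ σ : Fin K → Bool, ∑ π : Equiv.Perm V, ∑ i, g (π (e (i, σ i))) = K * m := by
        intro σ
        rw [Finset.sum_comm]
        rw [Finset.sum_congr rfl fun i _ => hall (e (i, σ i)) v0]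
        simp [hm]
      simp [this]
    have habs : |2 ^ K * (K * m)| ≤
        ∑ π : Equiv.Perm V, ∑ σ : Fin K → Bool, |∑ i, g (π (e (i, σ i)))| := by
      rw [← htot]
      refine (Finset.abs_sum_le_sum_abs _ _).trans ?_
      exact Finset.sum_le_sum fun π _ => Finset.abs_sum_le_sum_abs _ _
    refine le_trans ?_ habs
    rw [abs_mul, abs_mul, abs_of_pos h2K, abs_of_pos (by linarith : (0 : ℝ) < K)]
    have : Real.sqrt K / 5 * F ≤ K * |m| := by
      have h1 : Real.sqrt K ≤ K := by nlinarith
      calc _ ≤ K * (F / 2) := by nlinarith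
        _ ≤ _ := by gcongr
    nlinarith
lemma eps_bound {n k d : ℕ} {ε : ℝ} {f : (Fin n → Bool) → (Fin d → Bool) → Bool} (hd : 0 < d)
    (hkn : k < n) (hε : 0 < ε) (hf : IsNonMalleableExtractor n k d ε f) :
    1 ≤ 100 * ε ^ 2 * 2 ^ k := by
  classical
  obtain ⟨e⟩ : Nonempty (Fin (2 ^ k) × Bool ↪ (Fin n → Bool)) := by
    apply Function.Embedding.nonempty_of_card_le
    simp only [Fintype.card_prod, Fintype.card_fun, Fintype.card_bool, Fintype.card_fin]
    rw [← pow_succ]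
    exact Nat.pow_le_pow_right (by norm_num) hkn
  set F : ℝ := ((Fintype.card (Equiv.Perm (Fin n → Bool)) : ℕ) : ℝ) with hF
  have hF0 : 0 < F := by rw [hF]; exact_mod_cast Fintype.card_pos
  have h1 : ∀ (π : Equiv.Perm (Fin n → Bool)) (σ : Fin (2 ^ k) → Bool),
      ∑ s, |∑ i, sg (f (π (e (i, σ i))) s)| ≤ 2 * ε * (2 ^ k * 2 ^ d) := by
    intro π σ
    have hinj : Function.Injective (fun i => π (e (i, σ i))) := by
      intro i j h
      have := e.injective (π.injective h)
      exact (Prod.mk.inj this).1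
    have := bias_test hd hf (Finset.univ.image (fun i => π (e (i, σ i)))) (by
      rw [Finset.card_image_of_injective _ hinj]; simp)
    simpa only [Finset.sum_image (fun a _ b _ h => hinj h)] using this
  have h2 : ∑ π : Equiv.Perm (Fin n → Bool), ∑ σ : Fin (2 ^ k) → Bool,
      ∑ s, |∑ i, sg (f (π (e (i, σ i))) s)| ≤
      F * (2 ^ (2 ^ k) * (2 * ε * (2 ^ k * 2 ^ d))) := by
    refine (Finset.sum_le_sum fun π _ => Finset.sum_le_sum fun σ _ => h1 π σ).trans ?_
    simp only [Finset.sum_const, Finset.card_univ, nsmul_eq_mul, ← hF]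
    simp
  have h3 : ∑ π : Equiv.Perm (Fin n → Bool), ∑ σ : Fin (2 ^ k) → Bool,
      ∑ s, |∑ i, sg (f (π (e (i, σ i))) s)| =
      ∑ s, ∑ π : Equiv.Perm (Fin n → Bool), ∑ σ : Fin (2 ^ k) → Bool,
        |∑ i, sg (f (π (e (i, σ i))) s)| := by
    rw [Finset.sum_comm]
    conv_rhs => rw [Finset.sum_comm]
    rw [Finset.sum_comm]
    apply Finset.sum_congr rfl
    intro π _
    rw [Finset.sum_comm]
  have h4 : ∑ s : Fin d → Bool,
      Real.sqrt ((2 ^ k : ℕ) : ℝ) / 5 * (F * 2 ^ (2 ^ k)) ≤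
      ∑ s, ∑ π : Equiv.Perm (Fin n → Bool), ∑ σ : Fin (2 ^ k) → Bool,
        |∑ i, sg (f (π (e (i, σ i))) s)| :=
    Finset.sum_le_sum fun s _ =>
      rand_bias (fun x => sg (f x s)) (fun x => sg_sq _) (2 ^ k) (by positivity) e
  rw [← h3] at h4
  have h5 := h4.trans h2
  simp only [Finset.sum_const, Finset.card_univ, nsmul_eq_mul, Fintype.card_fun,
    Fintype.card_bool, Fintype.card_fin] at h5
  push_cast at h5
  set q := Real.sqrt ((2 : ℝ) ^ k) with hq
  have hq0 : 0 < q := Real.sqrt_pos.2 (by positivity)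
  have hq2 : q ^ 2 = 2 ^ k := Real.sq_sqrt (by positivity)
  rw [← hq2] at h5 ⊢
  have h6 : (2 ^ d * F * 2 ^ (2 ^ k) * q / 5) * 1 ≤
      (2 ^ d * F * 2 ^ (2 ^ k) * q / 5) * (10 * ε * q) := by
    calc _ = 2 ^ d * (q / 5 * (F * 2 ^ 2 ^ k)) := by ring
      _ ≤ _ := h5
      _ = _ := by ring
  have h7 := le_of_mul_le_mul_left h6 (by positivity)
  nlinarith

lemma code_bound {n k d : ℕ} {ε : ℝ} {f : (Fin n → Bool) → (Fin d → Bool) → Bool} (hd : 0 < d)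
    (hk : 0 < k) (hkn : k < n) (hε : 0 < ε) (hf : IsNonMalleableExtractor n k d ε f) (t : ℕ)
    (ht : 1 ≤ t) (htK : 2 * t ≤ 2 ^ k) (hmt : 2 ≤ (2 : ℝ) ^ d * (4 * ε) ^ (2 * t)) :
    (t : ℝ) ≤ 12 * (4 * ε) ^ 2 * 2 ^ k := by
  classical
  obtain ⟨X, -, hX⟩ := Finset.exists_subset_card_eq (s := (Finset.univ : Finset (Fin n → Bool)))
    (n := 2 ^ k) (by
      simp only [Finset.card_univ, Fintype.card_fun, Fintype.card_bool, Fintype.card_fin]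
      exact Nat.pow_le_pow_right (by norm_num) hkn.le)
  set G : Finset (Fin d → Bool) := Finset.univ.filter fun s =>
    ∀ s', s' ≠ s → |∑ x ∈ X, sg (f x s) * sg (f x s')| ≤ 4 * ε * 2 ^ k with hG
  have hA : ∀ s, ∃ s', s' ≠ s ∧
      (s ∉ G → 4 * ε * 2 ^ k ≤ |∑ x ∈ X, sg (f x s) * sg (f x s')|) := by
    intro s
    by_cases h : s ∈ G
    · refine ⟨fun i => !(s i), ?_, fun h' => absurd h h'⟩
      intro h
      have := congrFun h ⟨0, hd⟩
      simp at this
    · have h' := h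
      simp only [hG, Finset.mem_filter, Finset.mem_univ, true_and] at h'
      push Not at h'
      obtain ⟨s', h1, h2⟩ := h'
      exact ⟨s', h1, fun _ => h2.le⟩
  choose A hA1 hA2 using hA
  have hc := corr_test hf X hX A hA1
  have h1 : ((Gᶜ).card : ℝ) * (4 * ε * 2 ^ k) ≤ 2 * ε * (2 ^ k * 2 ^ d) := by
    refine le_trans ?_ hc
    rw [← nsmul_eq_mul]
    refine (Finset.card_nsmul_le_sum Gᶜ
      (fun s => |∑ x ∈ X, sg (f x s) * sg (f x (A s))|) _ ?_).trans ?_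
    · intro s hs
      exact hA2 s (by simpa using hs)
    · apply Finset.sum_le_sum_of_subset_of_nonneg (Finset.subset_univ _)
      intros; positivity
  have h2 : (G.card : ℝ) + (Gᶜ).card = 2 ^ d := by
    have := Finset.card_add_card_compl G
    simp only [Fintype.card_fun, Fintype.card_bool, Fintype.card_fin] at this
    exact_mod_cast this
  have hp : (0 : ℝ) < 2 * ε * 2 ^ k := by positivity
  have h3 : 2 * ((Gᶜ).card : ℝ) ≤ 2 ^ d := by
    have : (2 * ε * 2 ^ k) * (2 * ((Gᶜ).card : ℝ)) ≤ (2 * ε * 2 ^ k) * 2 ^ d := by linarith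
    exact le_of_mul_le_mul_left this hp
  have h4 : (2 : ℝ) ^ d ≤ 2 * G.card := by linarith
  have hcard : Fintype.card X = 2 ^ k := by simp [hX]
  have hw := welch G (fun s (x : X) => sg (f x.1 s)) (fun _ _ => sg_sq _) (4 * ε) (by
    intro i hi j hj hij
    simp only [hG, Finset.mem_filter, Finset.mem_univ, true_and] at hi
    have := hi j hij.symm
    rw [hcard]
    push_cast
    rw [← Finset.sum_coe_sort X (fun x => sg (f x i) * sg (f x j))] at this
    exact this) t
  rw [hcard] at hw
  have hpd : (0 : ℝ) < 2 ^ d := by positivity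
  have := alon_core (m := G.card) (K := ((2 ^ k : ℕ) : ℝ)) rfl ht htK
    (by positivity : 0 < 4 * ε) (by linarith) (by
      have : (2 : ℝ) ^ d * (4 * ε) ^ (2 * t) ≤ 2 * G.card * (4 * ε) ^ (2 * t) := by gcongr
      linarith) hw
  push_cast at this
  exact this

lemma main_ineq {n k d : ℕ} {ε : ℝ} {f : (Fin n → Bool) → (Fin d → Bool) → Bool} (hd : 0 < d)
    (hk : 0 < k) (hkn : k < n) (hε : 0 < ε) (hε1 : ε < 1 / 100)
    (hf : IsNonMalleableExtractor n k d ε f) :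
    (d : ℝ) ≤ 2 ^ 11 * (2 ^ k * ε ^ 2 * Real.logb 2 (1 / ε)) := by
  set L := Real.logb 2 (1 / ε) with hL
  have hL1 : 1 ≤ L := by
    rw [hL, Real.le_logb_iff_rpow_le (by norm_num) (by positivity), le_div_iff₀ hε]
    norm_num
    linarith
  have h2L : (2 : ℝ) ^ L = 1 / ε := Real.rpow_logb (by norm_num) (by norm_num) (by positivity)
  rcases le_total (d : ℝ) (8 * L) with h | h
  · have := eps_bound hd hkn hε hf
    have h2 : L * 1 ≤ L * (100 * ε ^ 2 * 2 ^ k) := by gcongr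
    have : 0 ≤ 2 ^ k * ε ^ 2 * L := by positivity
    nlinarith
  · set t0 := ⌊(d : ℝ) / (4 * L)⌋₊ with ht0
    have hx2 : 2 ≤ (d : ℝ) / (4 * L) := by
      rw [le_div_iff₀ (by positivity)]; linarith
    have ht1 : 1 ≤ t0 := Nat.le_floor (by push_cast; linarith)
    have hlow : (d : ℝ) / (8 * L) ≤ t0 := by
      have h1 := Nat.lt_floor_add_one ((d : ℝ) / (4 * L))
      rw [← ht0] at h1
      have h2 : (d : ℝ) / (8 * L) = (d / (4 * L)) / 2 := by field_simp; norm_num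
      rw [h2]
      linarith
    have hup : (t0 : ℝ) ≤ (d : ℝ) / (4 * L) := Nat.floor_le (by positivity)
    have hmt : ∀ t : ℕ, t ≤ t0 → 2 ≤ (2 : ℝ) ^ d * (4 * ε) ^ (2 * t) := by
      intro t ht
      have h1 : (t : ℝ) * (4 * L) ≤ d := by
        rw [← le_div_iff₀ (by positivity)]
        exact le_trans (by exact_mod_cast ht) hup
      have h2 : (1 / ε) ^ (2 * t) ≤ (2 : ℝ) ^ ((d : ℝ) - 1) := by
        rw [← h2L, ← Real.rpow_mul_natCast (by norm_num)]
        apply Real.rpow_le_rpow_of_exponent_le (by norm_num)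
        push_cast
        nlinarith
      rw [Real.rpow_sub (by norm_num), Real.rpow_natCast, Real.rpow_one, one_div, inv_pow,
        inv_le_iff_one_le_mul₀ (by positivity)] at h2
      have h3 : ε ^ (2 * t) ≤ (4 * ε) ^ (2 * t) := by
        apply pow_le_pow_left₀ hε.le; linarith
      have h4 : (2 : ℝ) ^ d * ε ^ (2 * t) ≤ 2 ^ d * (4 * ε) ^ (2 * t) := by gcongr
      linarith
    by_cases hc : 2 * t0 ≤ 2 ^ k
    · have h1 := code_bound hd hk hkn hε hf t0 ht1 hc (hmt t0 le_rfl)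
      have h2 := hlow.trans h1
      rw [div_le_iff₀ (by positivity)] at h2
      have : 0 ≤ 2 ^ k * ε ^ 2 * L := by positivity
      nlinarith
    · exfalso
      obtain ⟨k', rfl⟩ : ∃ k', k = k' + 1 := ⟨k - 1, by omega⟩
      have h1 := code_bound hd hk hkn hε hf (2 ^ k') Nat.one_le_two_pow
        (by rw [pow_succ]; omega) (hmt _ (by rw [pow_succ] at hc; omega))
      push_cast at h1
      rw [pow_succ (2 : ℝ) k'] at h1
      have hp : (0 : ℝ) < 2 ^ k' := by positivity
      have h5 : ε ^ 2 < (1 / 100) ^ 2 := by gcongr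
      nlinarith
/-- There are absolute constants `C > 0` and `c₀ ∈ (0,1)` such that for all positive
integers `n, k, d` with `k < n` and every `ε ∈ (0, c₀)`, any `(k,ε)`-non-malleable
extractor `{0,1}^n × {0,1}^d → {0,1}` satisfies
`k ≥ log₂(log₂(n − k)) + 2·log₂(1/ε) − log₂(log₂(1/ε)) − C`. -/
theorem nmExt_loglog_entropy_lower_bound :
    ∃ C : ℝ, 0 < C ∧ ∃ c₀ : ℝ, 0 < c₀ ∧ c₀ < 1 ∧
      ∀ n k d : ℕ, 0 < n → 0 < k → 0 < d → k < n →
        ∀ ε : ℝ, 0 < ε → ε < c₀ →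
          ∀ nmExt : (Fin n → Bool) → (Fin d → Bool) → Bool,
            IsNonMalleableExtractor n k d ε nmExt →
              (k : ℝ) ≥ Real.logb 2 (Real.logb 2 ((n : ℝ) - (k : ℝ))) +
                2 * Real.logb 2 (1 / ε) - Real.logb 2 (Real.logb 2 (1 / ε)) - C := by
  refine ⟨11, by norm_num, 1 / 100, by norm_num, by norm_num, ?_⟩
  intro n k d hn hk hd hkn ε hε hε1 f hf
  have hmain := main_ineq hd hk hkn hε hε1 hf
  have hseed := seed_bound hd hkn (by linarith) hf
  have hdR : (1 : ℝ) ≤ d := by exact_mod_cast hd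
  have hnk1 : (1 : ℝ) ≤ (n : ℝ) - k := by
    have : (k : ℝ) + 1 ≤ n := by exact_mod_cast hkn
    linarith
  have hnkd : (n : ℝ) - k ≤ 2 ^ d := by
    have : ((n - k : ℕ) : ℝ) ≤ 2 ^ d := by exact_mod_cast hseed
    rwa [Nat.cast_sub hkn.le] at this
  have hlog : Real.logb 2 ((n : ℝ) - k) ≤ d := by
    rw [Real.logb_le_iff_le_rpow (by norm_num) (by linarith), Real.rpow_natCast]
    exact hnkd
  have hlog0 : 0 ≤ Real.logb 2 ((n : ℝ) - k) := Real.logb_nonneg (by norm_num) hnk1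
  have hll : Real.logb 2 (Real.logb 2 ((n : ℝ) - k)) ≤ Real.logb 2 d := by
    rcases hlog0.eq_or_lt with h | h
    · rw [← h, Real.logb_zero]
      exact Real.logb_nonneg (by norm_num) hdR
    · exact Real.logb_le_logb_of_le (by norm_num) h hlog
  have hL0 : 0 < Real.logb 2 (1 / ε) := by
    apply Real.logb_pos (by norm_num)
    rw [lt_div_iff₀ hε]
    linarith
  have h1 := Real.logb_le_logb_of_le (b := 2) (by norm_num) (by linarith) hmain
  have e1 : Real.logb 2 (1 / ε) = - Real.logb 2 ε := by
    rw [one_div, Real.logb_inv]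
  have e2 : ∀ j : ℕ, Real.logb 2 ((2 : ℝ) ^ j) = j := by
    intro j
    rw [Real.logb_pow, Real.logb_self_eq_one (by norm_num), mul_one]
  rw [Real.logb_mul (by positivity) (by positivity), Real.logb_mul (by positivity) (by positivity),
    Real.logb_mul (by positivity) (by positivity), e2, e2, Real.logb_pow] at h1
  push_cast at h1
  linarith
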